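/- arXiv:2212.03418 — 2 statements merged into one kernel-verified Lean document; each statement's English description precedes it below -/
import Mathlib

section
/- Let g, h₁, h₂ be polynomials with rational coefficients. If α is a nonzero complex number satisfying h₁(α)·sin(g(α)) = h₂(α), such that h₁(α) ≠ 0, g(α) ≠ 0, sin(g(α)) ≠ 0, and h₂(α) ≠ 0, then α is transcendental. -/
section

open Polynomial

theorem IsIntegral.pow_mul_aeval {K : Type*} [CommRing K] {d : ℤ} {x : K}
    (h : IsIntegral ℤ (d * x)) (g : ℤ[X]) {N : ℕ} (hN : g.natDegree ≤ N) :
    IsIntegral ℤ ((d : K) ^ N * aeval x g) := by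
  rw [aeval_eq_sum_range' (Nat.lt_succ_of_le hN), Finset.mul_sum]
  refine IsIntegral.sum _ fun i hi => ?_
  have hi' : i ≤ N := by simpa [Nat.lt_succ_iff] using hi
  have : (d : K) ^ N * g.coeff i • x ^ i = ((g.coeff i * d ^ (N - i) : ℤ) : K) * (d * x) ^ i := by
    rw [← Nat.sub_add_cancel hi', pow_add, Nat.add_sub_cancel, zsmul_eq_mul]
    push_cast
    ring
  rw [this]
  exact (isIntegral_algebraMap (x := g.coeff i * d ^ (N - i))).mul (h.pow i)

theorem exists_int_polynomial_eval_zero_ne_zero {K : Type*} [Field K] [CharZero K]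
    [Algebra.IsAlgebraic ℤ K] {S : Finset K} (hS : 0 ∉ S) :
    ∃ f : ℤ[X], f.eval 0 ≠ 0 ∧ ∀ x ∈ S, aeval x f = 0 := by
  have key (x : K) : ∃ f : ℤ[X], x ≠ 0 → f.eval 0 ≠ 0 ∧ aeval x f = 0 := by
    by_cases hx : x = 0
    · exact ⟨0, fun h => (h hx).elim⟩
    · obtain ⟨f, h0, hf⟩ :=
        (Algebra.IsAlgebraic.isAlgebraic (R := ℤ) x).exists_nonzero_coeff_and_aeval_eq_zero
          (mem_nonZeroDivisors_of_ne_zero hx)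
      exact ⟨f, fun _ => ⟨by rwa [← coeff_zero_eq_eval_zero], hf⟩⟩
  choose F hF using key
  have hne : ∀ x ∈ S, x ≠ 0 := fun x hx h => hS (h ▸ hx)
  refine ⟨∏ x ∈ S, F x, ?_, fun x hx => ?_⟩
  · rw [eval_prod]
    exact Finset.prod_ne_zero_iff.mpr fun x hx => (hF x (hne x hx)).1
  · rw [map_prod]
    exact Finset.prod_eq_zero hx (hF x (hne x hx)).2

theorem exists_int_eq_of_isIntegral_of_fixed {K : Type*} [Field K] [NumberField K] [IsGalois ℚ K]
    {x : K} (hx : IsIntegral ℤ x) (hfix : ∀ σ : K ≃ₐ[ℚ] K, σ x = x) : ∃ m : ℤ, (m : K) = x := by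
  obtain ⟨q, rfl⟩ := (IsGalois.mem_range_algebraMap_iff_fixed x).mpr hfix
  obtain ⟨m, rfl⟩ := IsIntegrallyClosed.isIntegral_iff.mp
    ((isIntegral_algebraMap_iff (algebraMap ℚ K).injective).mp hx)
  exact ⟨m, by simp⟩

open Filter Topology in
theorem tendsto_const_mul_pow_div_factorial_pred (B C : ℝ) :
    Tendsto (fun p : ℕ => B * (C ^ p / ((p - 1).factorial : ℝ))) atTop (𝓝 0) := by
  have h := ((FloorSemiring.tendsto_pow_div_factorial_atTop C).comp
    (tendsto_sub_atTop_nat 1)).const_mul (B * C)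
  rw [mul_zero] at h
  refine h.congr' ?_
  filter_upwards [eventually_ge_atTop 1] with p hp
  obtain ⟨k, rfl⟩ := Nat.exists_eq_add_of_le' hp
  simp [pow_succ]
  ring

theorem add_sum_mul_exp_ne_zero {K : Type*} [Field K] [NumberField K] [IsGalois ℚ K]
    (φ : K →+* ℂ) {S : Finset K} (hS : 0 ∉ S) {a : K → ℤ} {b : ℤ} (hb : b ≠ 0)
    (hSσ : ∀ σ : K ≃ₐ[ℚ] K, ∀ x ∈ S, σ x ∈ S) (haσ : ∀ (σ : K ≃ₐ[ℚ] K) (x : K), a (σ x) = a x) :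
    (b : ℂ) + ∑ x ∈ S, (a x : ℂ) * Complex.exp (φ x) ≠ 0 := by
  intro hsum
  have : Algebra.IsAlgebraic ℤ K := (IsFractionRing.comap_isAlgebraic_iff (K := ℚ)).mpr inferInstance
  obtain ⟨f, hf0, hfS⟩ := exists_int_polynomial_eval_zero_ne_zero hS
  have hf : f ≠ 0 := by rintro rfl; simp at hf0
  set d : ℤ := f.leadingCoeff
  have hd : d ≠ 0 := leadingCoeff_ne_zero.mpr hf
  set M := f.natDegree
  obtain ⟨c, hc⟩ := LindemannWeierstrass.exp_polynomial_approx f hf0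
  have hφ (x : K) (q : ℤ[X]) : aeval (φ x) q = φ (aeval x q) :=
    aeval_algHom_apply φ.toIntAlgHom x q
  have hroots : ∀ x ∈ S, φ x ∈ f.aroots ℂ := fun x hx => by
    rw [mem_aroots, hφ, hfS x hx, map_zero]
    exact ⟨hf, rfl⟩
  set B : ℝ := ∑ x ∈ S, |(a x : ℝ)|
  obtain ⟨p₀, hp₀⟩ := Filter.eventually_atTop.mp
    ((tendsto_const_mul_pow_div_factorial_pred B (|(d : ℝ)| ^ M * c)).eventually_lt_const one_pos)
  obtain ⟨p, hp_ge, hp⟩ := Nat.exists_infinite_primes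
    (p₀ + ((eval 0 f).natAbs + 1) + (d.natAbs + 1) + (b.natAbs + 1))
  obtain ⟨n, hn, g, hg, happ⟩ := hc p (by lia) hp
  obtain ⟨m, hm⟩ : ∃ m : ℤ, (m : K) = (d : K) ^ (p * M) * ∑ x ∈ S, (a x : K) * aeval x g := by
    refine exists_int_eq_of_isIntegral_of_fixed ?_ fun σ => ?_
    · rw [Finset.mul_sum]
      refine IsIntegral.sum _ fun x hx => ?_
      rw [mul_left_comm]
      refine (isIntegral_algebraMap (x := a x)).mul (IsIntegral.pow_mul_aeval ?_ g (by lia))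
      simpa [zsmul_eq_mul] using isIntegral_leadingCoeff_smul f x (hfS x hx)
    · simp only [map_mul, map_pow, map_intCast, map_sum]
      congr 1
      refine Finset.sum_bij (fun x _ => σ x) (hSσ σ) (fun _ _ _ _ h => σ.injective h)
        (fun x hx => ⟨σ.symm x, hSσ σ.symm x hx, by simp⟩) fun x _ => ?_
      rw [haσ]
      congr 1
      exact (aeval_algHom_apply (σ : K →+* K).toIntAlgHom x g).symm
  have hm' : (m : ℂ) = (d : ℂ) ^ (p * M) * ∑ x ∈ S, (a x : ℂ) * aeval (φ x) g := by
    simpa [hφ] using congrArg φ hm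
  have hN : ((d ^ (p * M) * n * b + p * m : ℤ) : ℂ) =
      -((d : ℂ) ^ (p * M) *
        ∑ x ∈ S, (a x : ℂ) * (n • Complex.exp (φ x) - p • aeval (φ x) g)) := by
    have : ∑ x ∈ S, (a x : ℂ) * (n • Complex.exp (φ x) - p • aeval (φ x) g) =
        n * ∑ x ∈ S, (a x : ℂ) * Complex.exp (φ x) - p * ∑ x ∈ S, (a x : ℂ) * aeval (φ x) g := by
      rw [Finset.mul_sum, Finset.mul_sum, ← Finset.sum_sub_distrib]
      refine Finset.sum_congr rfl fun x _ => ?_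
      rw [zsmul_eq_mul, nsmul_eq_mul]
      ring
    rw [this, eq_neg_of_add_eq_zero_right hsum]
    push_cast
    rw [hm']
    ring
  have hlt : |((d ^ (p * M) * n * b + p * m : ℤ) : ℝ)| < 1 := by
    rw [← Complex.norm_intCast, hN, norm_neg, norm_mul, norm_pow, Complex.norm_intCast]
    calc _ ≤ |(d : ℝ)| ^ (p * M) * (∑ x ∈ S, |(a x : ℝ)| * (c ^ p / (p - 1).factorial)) := by
          gcongr
          refine norm_sum_le_of_le _ fun x hx => ?_
          rw [norm_mul, Complex.norm_intCast]
          gcongr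
          exact happ (hroots x hx)
      _ = B * ((|(d : ℝ)| ^ M * c) ^ p / ((p - 1).factorial : ℝ)) := by
          rw [← Finset.sum_mul, mul_pow, ← pow_mul, mul_comm M p]
          ring
      _ < 1 := hp₀ p (by lia)
  have hzero : d ^ (p * M) * n * b + p * m = 0 := Int.abs_lt_one_iff.mp (by exact_mod_cast hlt)
  have hdvd : (p : ℤ) ∣ d ^ (p * M) * n * b :=
    (dvd_add_left (dvd_mul_right _ m)).mp (hzero ▸ dvd_zero _)
  have hsmall {z : ℤ} (hz : z ≠ 0) (hzp : z.natAbs < p) : ¬ (p : ℤ) ∣ z := fun h =>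
    (Nat.le_of_dvd (Int.natAbs_pos.mpr hz) (Int.natCast_dvd.mp h)).not_gt hzp
  have hp' := Nat.prime_iff_prime_int.mp hp
  rcases hp'.dvd_or_dvd hdvd with h | h
  · rcases hp'.dvd_or_dvd h with h | h
    · exact hsmall hd (by lia) (hp'.dvd_of_dvd_pow h)
    · exact hn h
  · exact hsmall hb (by lia) h

theorem AddMonoidAlgebra.coeff_mapDomain_equiv_apply {R M N : Type*} [Semiring R] (e : M ≃ N)
    (P : AddMonoidAlgebra R M) (x : M) : (P.mapDomain e).coeff (e x) = P.coeff x := by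
  simp [AddMonoidAlgebra.mapDomain, Finsupp.mapDomain_apply e.injective]

/-- Evaluation of formal sums `∑ a x • [x]` at `∑ a x * exp (φ x)`. -/
noncomputable def expSum {K : Type*} [Ring K] (φ : K →+* ℂ) : AddMonoidAlgebra ℤ K →ₐ[ℤ] ℂ :=
  AddMonoidAlgebra.lift ℤ ℂ K
    (Complex.expMonoidHom.comp φ.toAddMonoidHom.toMultiplicative)

theorem expSum_apply {K : Type*} [Ring K] (φ : K →+* ℂ) (P : AddMonoidAlgebra ℤ K) :
    expSum φ P = ∑ x ∈ P.coeff.support, (P.coeff x : ℂ) * Complex.exp (φ x) := by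
  simp [expSum, AddMonoidAlgebra.lift_apply, Finsupp.sum, Complex.expMonoidHom]

theorem expSum_single {K : Type*} [Ring K] (φ : K →+* ℂ) (x : K) (a : ℤ) :
    expSum φ (.single x a) = a * Complex.exp (φ x) := by
  simp [expSum, Complex.expMonoidHom]

theorem expSum_ne_zero_of_fixed {K : Type*} [Field K] [NumberField K] [IsGalois ℚ K]
    (φ : K →+* ℂ) {P : AddMonoidAlgebra ℤ K} (h0 : P.coeff 0 ≠ 0)
    (hP : ∀ σ : K ≃ₐ[ℚ] K, P.mapDomain σ = P) : expSum φ P ≠ 0 := by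
  classical
  have hcoeff (σ : K ≃ₐ[ℚ] K) (x : K) : P.coeff (σ x) = P.coeff x := by
    conv_lhs => rw [← hP σ]
    exact AddMonoidAlgebra.coeff_mapDomain_equiv_apply σ.toEquiv P x
  have := add_sum_mul_exp_ne_zero φ (S := P.coeff.support.erase 0) (a := P.coeff) (by simp) h0
    (fun σ x hx => by simpa [hcoeff] using hx) hcoeff
  rw [expSum_apply, ← Finset.add_sum_erase _ _ (Finsupp.mem_support_iff.mpr h0)]
  simpa using this

/-- The exponentials of distinct algebraic numbers are linearly independent over `ℤ`. -/
theorem expSum_ne_zero {K : Type*} [Field K] [NumberField K] [IsGalois ℚ K]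
    (φ : K →+* ℂ) {P : AddMonoidAlgebra ℤ K} (hP : P ≠ 0) : expSum φ P ≠ 0 := by
  classical
  let T (σ : K ≃ₐ[ℚ] K) : AddMonoidAlgebra ℤ K →+* AddMonoidAlgebra ℤ K :=
    AddMonoidAlgebra.mapDomainRingHom ℤ (σ : K →+ K)
  have hTT (σ τ : K ≃ₐ[ℚ] K) (Q : AddMonoidAlgebra ℤ K) : T τ (T σ Q) = T (τ * σ) Q :=
    AddMonoidAlgebra.coeff_injective (Finsupp.mapDomain_comp (v := Q.coeff)).symm
  set Q := ∏ σ, T σ P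
  have hQ : Q ≠ 0 := Finset.prod_ne_zero_iff.mpr fun σ _ h => hP <|
    AddMonoidAlgebra.mapDomain_injective σ.injective (h.trans (map_zero (T σ)).symm)
  have hTQ (τ : K ≃ₐ[ℚ] K) : T τ Q = Q := by
    simp only [Q, map_prod, hTT]
    exact Fintype.prod_equiv (Equiv.mulLeft τ) _ _ fun _ => rfl
  obtain ⟨y, hy⟩ : ∃ y, Q.coeff y ≠ 0 := by
    by_contra! h
    exact hQ (AddMonoidAlgebra.coeff_injective (Finsupp.ext h))
  have hcoeff (σ : K ≃ₐ[ℚ] K) (x : K) : Q.coeff (σ x) = Q.coeff x := by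
    conv_lhs => rw [← hTQ σ]
    exact AddMonoidAlgebra.coeff_mapDomain_equiv_apply σ.toEquiv Q x
  set R := ∑ σ : K ≃ₐ[ℚ] K, (.single (σ (-y)) 1 : AddMonoidAlgebra ℤ K)
  have hTR (τ : K ≃ₐ[ℚ] K) : T τ R = R := by
    simp only [R, map_sum]
    refine Fintype.sum_equiv (Equiv.mulLeft τ) _ _ fun σ => ?_
    exact AddMonoidAlgebra.mapDomain_single
  have h0 : (Q * R).coeff 0 = Fintype.card (K ≃ₐ[ℚ] K) * Q.coeff y := by
    have (σ : K ≃ₐ[ℚ] K) : (Q * .single (σ (-y)) 1).coeff 0 = Q.coeff y := by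
      rw [AddMonoidAlgebra.coeff_mul_single_eq_coeff_mul (m₂ := σ y), hcoeff, mul_one]
      intro x _
      rw [map_neg, add_neg_eq_zero]
    simp only [R, Finset.mul_sum, AddMonoidAlgebra.coeff_sum, Finsupp.finsetSum_apply, this]
    simp
  have hQR : expSum φ (Q * R) ≠ 0 := by
    refine expSum_ne_zero_of_fixed φ ?_ fun σ => ?_
    · rw [h0]
      exact mul_ne_zero (by exact_mod_cast Fintype.card_ne_zero) hy
    · exact (map_mul (T σ) Q R).trans (by rw [hTQ, hTR])
  refine fun h => hQR ?_
  have hT1 : T 1 P = P := AddMonoidAlgebra.coeff_injective Finsupp.mapDomain_id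
  rw [map_mul, map_prod, Finset.prod_eq_zero (Finset.mem_univ 1) (by rw [hT1, h]), zero_mul]

theorem IsAlgebraic.exists_mem_isGalois {z : ℂ} (hz : IsAlgebraic ℚ z) :
    ∃ K : IntermediateField ℚ ℂ, NumberField K ∧ IsGalois ℚ K ∧ z ∈ K := by
  set p := minpoly ℚ z
  have hp : p ≠ 0 := minpoly.ne_zero hz.isIntegral
  have : IsSplittingField ℚ (IntermediateField.adjoin ℚ (p.rootSet ℂ)) p :=
    IntermediateField.adjoin_rootSet_isSplittingField
      (IsAlgClosed.splits (p.map (algebraMap ℚ ℂ)))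
  have : FiniteDimensional ℚ (IntermediateField.adjoin ℚ (p.rootSet ℂ)) :=
    IsSplittingField.finiteDimensional _ p
  have : Normal ℚ (IntermediateField.adjoin ℚ (p.rootSet ℂ)) := Normal.of_isSplittingField p
  exact ⟨_, ⟨⟩, ⟨⟩, IntermediateField.subset_adjoin _ _
    (mem_rootSet.mpr ⟨hp, minpoly.aeval ℚ z⟩)⟩

/-- **Hermite–Lindemann theorem** -/
theorem Complex.transcendental_exp {z : ℂ} (hz : IsAlgebraic ℚ z) (hz0 : z ≠ 0) :
    Transcendental ℚ (Complex.exp z) := by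
  intro hexp
  obtain ⟨K, _, _, hzK⟩ := hz.exists_mem_isGalois
  obtain ⟨q, hq0, hq⟩ := (IsFractionRing.isAlgebraic_iff ℤ ℚ ℂ).mpr hexp
  let y : K := ⟨z, hzK⟩
  have hy : y ≠ 0 := fun h => hz0 (congrArg Subtype.val h)
  let F : ℤ[X] →ₐ[ℤ] ℂ := ((expSum (algebraMap K ℂ)).comp
    (AddMonoidAlgebra.mapDomainAlgHom ℤ ℤ (multiplesHom K y))).comp
    (toFinsuppIsoAlg ℤ).toAlgHom
  have hF : F = aeval (Complex.exp z) := by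
    refine Polynomial.algHom_ext ?_
    simp [F, expSum_single, y]
  refine expSum_ne_zero (algebraMap K ℂ)
    (P := q.toFinsupp.mapDomain (multiplesHom K y)) (fun h => hq0 ?_)
    ((DFunLike.congr_fun hF q).trans hq)
  have hinj : Function.Injective (multiplesHom K y) := fun m n h => by simpa [hy] using h
  exact toFinsupp_eq_zero.mp
    (AddMonoidAlgebra.mapDomain_injective hinj (h.trans (AddMonoidAlgebra.mapDomain_zero _).symm))

theorem Complex.transcendental_sin {z : ℂ} (hz : IsAlgebraic ℚ z) (hz0 : z ≠ 0) :
    Transcendental ℚ (Complex.sin z) := by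
  intro hsin
  have hI : IsAlgebraic ℚ Complex.I := by
    refine .of_pow two_pos ?_
    rw [Complex.I_sq]
    exact isAlgebraic_one.neg
  have hcos : IsAlgebraic ℚ (Complex.cos z) := by
    refine .of_pow two_pos ?_
    rw [Complex.cos_sq']
    exact isAlgebraic_one.sub (hsin.pow 2)
  refine Complex.transcendental_exp (hz.mul hI) (mul_ne_zero hz0 Complex.I_ne_zero) ?_
  rw [Complex.exp_mul_I]
  exact hcos.add (hsin.mul hI)


end

/-- If `α ≠ 0` satisfies `h₁(α)·sin(g(α)) = h₂(α)` with `h₁(α) ≠ 0`, `g(α) ≠ 0`,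
`sin(g(α)) ≠ 0`, `h₂(α) ≠ 0`, then `α` is transcendental. -/
theorem transcendental_of_sin_comp (g h₁ h₂ : Polynomial ℚ) (α : ℂ) (hα : α ≠ 0)
    (hg : Polynomial.aeval α g ≠ 0)
    (hh₁ : Polynomial.aeval α h₁ ≠ 0)
    (hsin : Complex.sin (Polynomial.aeval α g) ≠ 0)
    (hh₂ : Polynomial.aeval α h₂ ≠ 0)
    (heq : Polynomial.aeval α h₁ * Complex.sin (Polynomial.aeval α g) =
      Polynomial.aeval α h₂) :
    Transcendental ℚ α := by
  intro halg
  have hpoly (p : Polynomial ℚ) : IsAlgebraic ℚ (Polynomial.aeval α p) := by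
    rw [Polynomial.aeval_eq_sum_range]
    exact (IsIntegral.sum _ fun i _ => (halg.isIntegral.pow i).smul _).isAlgebraic
  refine Complex.transcendental_sin (hpoly g) hg ?_
  rw [eq_div_of_mul_eq hh₁ ((mul_comm _ _).trans heq), div_eq_mul_inv]
  exact (hpoly h₂).mul (hpoly h₁).inv
end

section
/- For every nonzero algebraic complex number α, the number sin(α) is transcendental. -/
open Polynomial in
/-- If `D * x` is integral and `g` has degree at most `k`, then `D ^ k * g(x)` is integral. -/
theorem isIntegral_pow_mul_aeval {K : Type*} [Field K] {D : ℤ} {x : K}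
    (hx : IsIntegral ℤ ((D : K) * x)) {g : ℤ[X]} {k : ℕ} (hg : g.natDegree ≤ k) :
    IsIntegral ℤ ((D : K) ^ k * aeval x g) := by
  rw [aeval_eq_sum_range' (Nat.lt_succ_of_le hg), Finset.mul_sum]
  refine IsIntegral.sum _ fun i hi => ?_
  have hik : i ≤ k := Nat.lt_succ_iff.mp (Finset.mem_range.mp hi)
  have h : (D : K) ^ k * g.coeff i • x ^ i =
      ((D ^ (k - i) * g.coeff i : ℤ) : K) * ((D : K) * x) ^ i := by
    rw [← Nat.sub_add_cancel hik, pow_add, zsmul_eq_mul, mul_pow, Nat.add_sub_cancel]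
    push_cast
    ring
  rw [h]
  exact (map_isIntegral_int (Int.castRingHom K) isIntegral_algebraMap).mul (hx.pow i)

open Polynomial in
/-- An integer polynomial, nonzero at `0`, vanishing at finitely many given nonzero elements. -/
theorem exists_eval_zero_ne_zero_and_aeval_eq_zero {K : Type*} [Field K] [NumberField K]
    (S : Finset K) (hS : ∀ x ∈ S, x ≠ 0) :
    ∃ f : ℤ[X], f.eval 0 ≠ 0 ∧ ∀ x ∈ S, aeval x f = 0 := by
  have h (x : K) : ∃ q : ℤ[X], q.coeff 0 ≠ 0 ∧ (x ≠ 0 → aeval x q = 0) := by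
    by_cases hx : x = 0
    · exact ⟨1, by simp, fun h => absurd hx h⟩
    · have hx' : IsAlgebraic ℤ x :=
        (IsFractionRing.isAlgebraic_iff ℤ ℚ K).mpr (Algebra.IsAlgebraic.isAlgebraic x)
      obtain ⟨q, hq, hqx⟩ :=
        hx'.exists_nonzero_coeff_and_aeval_eq_zero (mem_nonZeroDivisors_of_ne_zero hx)
      exact ⟨q, hq, fun _ => hqx⟩
  choose q hq hqx using h
  refine ⟨∏ x ∈ S, q x, ?_, fun x hx => ?_⟩
  · rw [eval_prod, Finset.prod_ne_zero_iff]
    intro x _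
    rw [← coeff_zero_eq_eval_zero]
    exact hq x
  · rw [map_prod]
    exact Finset.prod_eq_zero hx (hqx x (hS x hx))

theorem tendsto_mul_pow_div_factorial_pred (A B : ℝ) :
    Filter.Tendsto (fun p : ℕ => A * (B ^ p / (p - 1).factorial)) Filter.atTop (nhds 0) := by
  rw [← Filter.tendsto_add_atTop_iff_nat 1]
  have h := (FloorSemiring.tendsto_pow_div_factorial_atTop B).const_mul (A * B)
  rw [mul_zero] at h
  refine h.congr fun n => ?_
  rw [Nat.add_sub_cancel, pow_succ]
  ring

open Polynomial in
/-- In a number field, a relation `1 + ∑ c x * exp x = 0` over finitely many nonzero `x` cannot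
hold under all complex embeddings simultaneously. -/
theorem not_forall_embedding_one_add_sum_mul_exp_eq_zero {K : Type*} [Field K] [NumberField K]
    (S : Finset K) (hS : ∀ x ∈ S, x ≠ 0) (c : K → K) :
    ¬ ∀ σ : K →ₐ[ℚ] ℂ, 1 + ∑ x ∈ S, σ (c x) * Complex.exp (σ x) = 0 := by
  classical
  intro hrel
  obtain ⟨f, hf0, hf⟩ := exists_eval_zero_ne_zero_and_aeval_eq_zero S hS
  obtain ⟨M, hM⟩ := LindemannWeierstrass.exp_polynomial_approx f hf0
  obtain ⟨D, hD0, hD⟩ := exists_integral_multiples ℤ ℚ (S ∪ S.image c)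
  simp only [zsmul_eq_mul] at hD
  set m := f.natDegree
  set d := Fintype.card (K →ₐ[ℚ] ℂ)
  have hd : d ≠ 0 :=
    (AlgHom.card ℚ K ℂ).trans_ne (Module.finrank_pos (R := ℚ) (M := K)).ne'
  set A : ℝ := ∑ σ : K →ₐ[ℚ] ℂ, ∑ x ∈ S, ‖σ (c x)‖
  have hsmall := (tendsto_mul_pow_div_factorial_pred (|(D : ℝ)| * A)
    (|(D : ℝ)| ^ m * M)).eventually_lt_const one_pos
  obtain ⟨N, hN⟩ := Filter.eventually_atTop.mp hsmall
  obtain ⟨p, hp, hprime⟩ :=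
    Nat.exists_infinite_primes (N + (eval 0 f).natAbs + D.natAbs + d + 1)
  specialize hN p (by omega)
  obtain ⟨n, hpn, g, hg, hgr⟩ := hM p (by omega) hprime
  set T : K := ∑ x ∈ S, c x * aeval x g
  have hint : IsIntegral ℤ ((D : K) ^ (p * m + 1) * T) := by
    rw [Finset.mul_sum]
    refine IsIntegral.sum _ fun x hx => ?_
    have h1 := hD (c x) (Finset.mem_union_right _ (Finset.mem_image_of_mem c hx))
    have h2 := isIntegral_pow_mul_aeval (hD x (Finset.mem_union_left _ hx))
      (hg.trans (Nat.sub_le _ _))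
    convert h1.mul h2 using 1
    ring
  obtain ⟨z, hz⟩ := IsIntegrallyClosed.isIntegral_iff.mp
    (Algebra.isIntegral_trace (L := ℚ) hint)
  have hz' : (z : ℂ) = (D : ℂ) ^ (p * m + 1) * ∑ σ : K →ₐ[ℚ] ℂ, σ T := by
    have h := trace_eq_sum_embeddings (K := ℚ) ℂ (x := (D : K) ^ (p * m + 1) * T)
    rw [← hz] at h
    simp only [map_mul, map_pow, map_intCast, algebraMap_int_eq, eq_intCast] at h
    rw [h, Finset.mul_sum]
  have hroot (σ : K →ₐ[ℚ] ℂ) {x : K} (hx : x ∈ S) : σ x ∈ f.aroots ℂ := by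
    rw [mem_aroots]
    refine ⟨fun h => hf0 (by simp [h]), ?_⟩
    have h := aeval_algHom_apply (σ.restrictScalars ℤ) x f
    rw [hf x hx, map_zero] at h
    exact h
  have hσ (σ : K →ₐ[ℚ] ℂ) : (n : ℂ) + p * σ T =
      -∑ x ∈ S, σ (c x) * (n • Complex.exp (σ x) - p • aeval (σ x) g) := by
    have hT : σ T = ∑ x ∈ S, σ (c x) * aeval (σ x) g := by
      rw [map_sum]
      refine Finset.sum_congr rfl fun x _ => ?_
      rw [map_mul]
      congr 1
      exact (aeval_algHom_apply (σ.restrictScalars ℤ) x g).symm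
    have h : ∑ x ∈ S, σ (c x) * (n • Complex.exp (σ x) - p • aeval (σ x) g) =
        n * ∑ x ∈ S, σ (c x) * Complex.exp (σ x) - p * σ T := by
      rw [hT, Finset.mul_sum, Finset.mul_sum, ← Finset.sum_sub_distrib]
      refine Finset.sum_congr rfl fun x _ => ?_
      rw [zsmul_eq_mul, nsmul_eq_mul]
      ring
    rw [h]
    linear_combination (n : ℂ) * hrel σ
  have hbound : ‖∑ σ : K →ₐ[ℚ] ℂ, ((n : ℂ) + p * σ T)‖ ≤ A * (M ^ p / (p - 1).factorial) := by
    refine (norm_sum_le _ _).trans ?_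
    rw [Finset.sum_mul]
    refine Finset.sum_le_sum fun σ _ => ?_
    rw [hσ, norm_neg, Finset.sum_mul]
    refine (norm_sum_le _ _).trans (Finset.sum_le_sum fun x hx => ?_)
    rw [norm_mul]
    exact mul_le_mul_of_nonneg_left (hgr (hroot σ hx)) (norm_nonneg _)
  set w : ℤ := D ^ (p * m + 1) * (d * n) + p * z
  have hw : (w : ℂ) = (D : ℂ) ^ (p * m + 1) * ∑ σ : K →ₐ[ℚ] ℂ, ((n : ℂ) + p * σ T) := by
    rw [Finset.sum_add_distrib, ← Finset.mul_sum, Finset.sum_const, Finset.card_univ,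
      nsmul_eq_mul]
    simp only [w]
    push_cast
    rw [hz']
    ring
  have hw0 : w ≠ 0 := by
    intro h
    have hdvd : (p : ℤ) ∣ D ^ (p * m + 1) * (d * n) :=
      (dvd_add_left (dvd_mul_right _ z)).mp ((dvd_zero _).trans h.symm.dvd)
    have hpp := Nat.prime_iff_prime_int.mp hprime
    rcases hpp.dvd_or_dvd hdvd with h1 | h1
    · have := Nat.le_of_dvd (Int.natAbs_pos.mpr hD0) (Int.natCast_dvd.mp (hpp.dvd_of_dvd_pow h1))
      omega
    · rcases hpp.dvd_or_dvd h1 with h2 | h2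
      · have := Nat.le_of_dvd (Nat.pos_of_ne_zero hd) (Int.natCast_dvd_natCast.mp h2)
        omega
      · exact hpn h2
  have h1 : (1 : ℝ) ≤ ‖(w : ℂ)‖ := by
    rw [Complex.norm_intCast]
    exact_mod_cast Int.one_le_abs hw0
  refine absurd hN (not_lt.mpr (h1.trans ?_))
  rw [hw, norm_mul, norm_pow, Complex.norm_intCast]
  refine (mul_le_mul_of_nonneg_left hbound (by positivity)).trans_eq ?_
  rw [mul_pow, ← pow_mul, pow_succ, mul_comm m p]
  ring

/-- The ring homomorphism `∑ c x [x] ↦ ∑ σ (c x) * exp (σ x)`. -/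
noncomputable def AddMonoidAlgebra.expEval {K : Type*} [Field K] (σ : K →+* ℂ) :
    AddMonoidAlgebra K K →+* ℂ :=
  AddMonoidAlgebra.liftNCRingHom σ
    (Complex.expMonoidHom.comp (AddMonoidHom.toMultiplicative (σ : K →+ ℂ)))
    fun _ _ => Commute.all _ _

theorem AddMonoidAlgebra.expEval_single {K : Type*} [Field K] (σ : K →+* ℂ) (x c : K) :
    expEval σ (single x c) = σ c * Complex.exp (σ x) :=
  liftNC_single (σ : K →+ ℂ) _ x c

theorem AddMonoidAlgebra.expEval_apply {K : Type*} [Field K] (σ : K →+* ℂ)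
    (F : AddMonoidAlgebra K K) :
    expEval σ F = ∑ x ∈ F.coeff.support, σ (F.coeff x) * Complex.exp (σ x) := by
  conv_lhs => rw [← sum_coeff_single F]
  rw [Finsupp.sum, map_sum]
  exact Finset.sum_congr rfl fun x _ => expEval_single σ x _

/-- A nonzero element of the group algebra is not killed by the exponential evaluations at all
complex embeddings. -/
theorem AddMonoidAlgebra.exists_expEval_ne_zero {K : Type*} [Field K] [NumberField K]
    {F : AddMonoidAlgebra K K} (hF : F ≠ 0) :
    ∃ σ : K →ₐ[ℚ] ℂ, expEval (σ : K →+* ℂ) F ≠ 0 := by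
  classical
  by_contra! h
  obtain ⟨y, hy⟩ : ∃ y, F.coeff y ≠ 0 := by
    by_contra! h0
    exact hF (by ext x; simpa using h0 x)
  set H := F * single (-y) (F.coeff y)⁻¹
  have hH0 : H.coeff 0 = 1 := by
    simp [H, hy]
  have hmem : (0 : K) ∈ H.coeff.support := by simp [hH0]
  refine not_forall_embedding_one_add_sum_mul_exp_eq_zero (H.coeff.support.erase 0)
    (fun x hx => Finset.ne_of_mem_erase hx) H.coeff fun σ => ?_
  have hσ : expEval (σ : K →+* ℂ) H = 0 := by rw [map_mul, h σ, zero_mul]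
  rw [expEval_apply, ← Finset.add_sum_erase _ _ hmem, hH0] at hσ
  simpa using hσ

/-- The **Hermite–Lindemann theorem**. -/
theorem transcendental_exp_of_isAlgebraic {a : ℂ} (ha : a ≠ 0) (halg : IsAlgebraic ℚ a) :
    Transcendental ℚ (Complex.exp a) := by
  classical
  intro hb
  set q := minpoly ℚ a * minpoly ℚ (Complex.exp a)
  have hq : q ≠ 0 := mul_ne_zero (minpoly.ne_zero halg.isIntegral) (minpoly.ne_zero hb.isIntegral)
  let K := IntermediateField.adjoin ℚ (q.rootSet ℂ)
  have hsplit : q.IsSplittingField ℚ K :=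
    IntermediateField.adjoin_rootSet_isSplittingField (IsAlgClosed.splits _)
  have : FiniteDimensional ℚ K := Polynomial.IsSplittingField.finiteDimensional K q
  have : NumberField K := {}
  have : Normal ℚ K := Normal.of_isSplittingField q
  have haK : a ∈ K := IntermediateField.subset_adjoin _ _ <| by
    rw [Polynomial.mem_rootSet]
    exact ⟨hq, by simp [q]⟩
  have hbK : Complex.exp a ∈ K := IntermediateField.subset_adjoin _ _ <| by
    rw [Polynomial.mem_rootSet]
    exact ⟨hq, by simp [q]⟩
  let a' : K := ⟨a, haK⟩
  let b' : K := ⟨Complex.exp a, hbK⟩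
  have ha' : a' ≠ 0 := fun h => ha (congrArg Subtype.val h)
  let E (τ : K ≃ₐ[ℚ] K) : AddMonoidAlgebra K K :=
    AddMonoidAlgebra.single (τ a') 1 - AddMonoidAlgebra.single 0 (τ b')
  have hE (τ : K ≃ₐ[ℚ] K) : E τ ≠ 0 := by
    intro h
    have hτ : τ a' ≠ 0 := by simpa using ha'
    have := congrArg (fun F => F.coeff (τ a')) h
    simp [E, hτ.symm] at this
  obtain ⟨σ, hσ⟩ := AddMonoidAlgebra.exists_expEval_ne_zero
    (Finset.prod_ne_zero_iff.mpr fun τ (_ : τ ∈ Finset.univ) => hE τ)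
  obtain ⟨τ, rfl⟩ := (Normal.algHomEquivAut ℚ ℂ K).symm.surjective σ
  refine hσ ?_
  rw [map_prod]
  refine Finset.prod_eq_zero (Finset.mem_univ τ⁻¹) ?_
  have hτ (x : K) : (Normal.algHomEquivAut ℚ ℂ K).symm τ (τ⁻¹ x) = (x : ℂ) :=
    congrArg Subtype.val (τ.apply_symm_apply x)
  rw [map_sub, AddMonoidAlgebra.expEval_single, AddMonoidAlgebra.expEval_single]
  simp only [RingHom.coe_coe, hτ, map_one, map_zero, Complex.exp_zero, one_mul, mul_one]
  exact sub_self _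

/-- For every nonzero algebraic complex number `α`, `sin α` is transcendental. -/
theorem transcendental_sin_of_algebraic (α : ℂ) (hα : α ≠ 0)
    (halg : IsAlgebraic ℚ α) : Transcendental ℚ (Complex.sin α) := by
  intro hs
  have hI : IsAlgebraic ℚ Complex.I :=
    (IsIntegral.of_pow two_pos (by rw [Complex.I_sq]; exact isIntegral_one.neg)).isAlgebraic
  have hcos : IsAlgebraic ℚ (Complex.cos α) := by
    refine (IsIntegral.of_pow two_pos ?_).isAlgebraic
    rw [Complex.cos_sq']
    exact isIntegral_one.sub (hs.isIntegral.pow 2)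
  refine transcendental_exp_of_isAlgebraic (mul_ne_zero hα Complex.I_ne_zero) (halg.mul hI) ?_
  rw [Complex.exp_mul_I]
  exact hcos.add (hs.mul hI)
end
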